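/- Euler insertion in the genus-0 four-point function: for all constant vector fields v₁, v₂, one has Σ_α ⟨⟨E v₁ v₂ γ^α⟩⟩₀ γ_α = G(v₁)∘v₂ + v₁∘G(v₂) − G(v₁∘v₂) − b₁ v₁∘v₂. -/

import Mathlib

open scoped BigOperators

/-- Points of the small phase space `ℂ^N`. -/
abbrev Pt (N : ℕ) := Fin N → ℂ

/-- Vector fields on `ℂ^N` (components with respect to the basis `γ_α`). -/
abbrev VF (N : ℕ) := Pt N → Pt N

/-- Partial derivative `∂/∂t^α`. -/
noncomputable def pd {N : ℕ} (α : Fin N) (F : Pt N → ℂ) : Pt N → ℂ :=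
  fun t => fderiv ℂ F t (Pi.single α 1)

/-- The `k`-point function `⟨⟨v₁ ⋯ v_k⟩⟩` associated with a generating function `F`. -/
noncomputable def corr {N : ℕ} : (Pt N → ℂ) → List (VF N) → Pt N → ℂ
  | F, [] => F
  | F, v :: vs => fun t => ∑ α, v t α * corr (pd α F) vs t

/-- Constant vector field associated with an element of `ℂ^N`. -/
def cvf {N : ℕ} (x : Pt N) : VF N := fun _ => x

/-- The basis vector field `γ_α`. -/
noncomputable def bas {N : ℕ} (α : Fin N) : VF N := cvf (Pi.single α 1)

/-- The dual basis vector field `γ^α = η^{αβ} γ_β`. -/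
noncomputable def dua {N : ℕ} (ηinv : Matrix (Fin N) (Fin N) ℂ) (α : Fin N) : VF N :=
  cvf (fun β => ηinv α β)

/-- The quantum product `v ∘ w := ⟨⟨v w γ^α⟩⟩₀ γ_α` of two vector fields. -/
noncomputable def qp {N : ℕ} (F : Pt N → ℂ) (ηinv : Matrix (Fin N) (Fin N) ℂ)
    (v w : VF N) : VF N :=
  fun t σ => corr F [v, w, dua ηinv σ] t

/-- The grading operator `G(Σ f_α γ_α) = Σ b_α f_α γ_α`. -/
def Gop {N : ℕ} (b : Fin N → ℂ) (v : VF N) : VF N := fun t α => b α * v t α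

/-- The Euler vector field `E = c + Σ_α (b₁ + 1 - b_α) t^α γ_α`. -/
def euler {N : ℕ} (c : Pt N) (b : Fin N → ℂ) (b1 : ℂ) : VF N :=
  fun t α => c α + (b1 + 1 - b α) * t α

/-- The quantum volume element `Δ := γ^α ∘ γ_α`. -/
noncomputable def qvol {N : ℕ} (F : Pt N → ℂ) (ηinv : Matrix (Fin N) (Fin N) ℂ) : VF N :=
  fun t => ∑ α, qp F ηinv (dua ηinv α) (bas α) t

/-- Covariant derivative `∇_v w` with respect to the trivial connection (`∇ γ_α = 0`). -/
noncomputable def nablaVF {N : ℕ} (v w : VF N) : VF N :=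
  fun t α => fderiv ℂ (fun s => w s α) t (v t)

/-- Derivative of a function along a vector field. -/
noncomputable def dirD {N : ℕ} (v : VF N) (f : Pt N → ℂ) : Pt N → ℂ :=
  fun t => fderiv ℂ f t (v t)

/-- Quantum powers of a vector field: `E⁰ := γ₁`, `E^{k+1} := E ∘ E^k`. -/
noncomputable def epow {N : ℕ} [NeZero N] (F : Pt N → ℂ) (ηinv : Matrix (Fin N) (Fin N) ℂ)
    (E : VF N) : ℕ → VF N
  | 0 => bas 0
  | k + 1 => qp F ηinv E (epow F ηinv E k)

/-- The genus-0 part `G₀` of Getzler's equation. -/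
noncomputable def G0func {N : ℕ} (F0 : Pt N → ℂ) (ηinv : Matrix (Fin N) (Fin N) ℂ)
    (v : Fin 4 → VF N) (t : Pt N) : ℂ :=
  ∑ g : Equiv.Perm (Fin 4),
    ((1/6) * ∑ α, corr F0 [v (g 0), v (g 1), v (g 2), dua ηinv α] t *
        (∑ β, corr F0 [bas α, v (g 3), bas β, dua ηinv β] t)
    + (1/24) * ∑ α, corr F0 [v (g 0), v (g 1), v (g 2), v (g 3), dua ηinv α] t *
        (∑ β, corr F0 [bas α, bas β, dua ηinv β] t)
    - (1/4) * ∑ α, ∑ β, corr F0 [v (g 0), v (g 1), dua ηinv α, dua ηinv β] t *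
        corr F0 [bas α, bas β, v (g 2), v (g 3)] t)

/-- The genus-1 part `G₁` of Getzler's equation. -/
noncomputable def G1func {N : ℕ} (F0 F1 : Pt N → ℂ) (ηinv : Matrix (Fin N) (Fin N) ℂ)
    (v : Fin 4 → VF N) (t : Pt N) : ℂ :=
  ∑ g : Equiv.Perm (Fin 4),
    (3 * corr F1 [qp F0 ηinv (v (g 0)) (v (g 1)), qp F0 ηinv (v (g 2)) (v (g 3))] t
    - 4 * corr F1 [qp F0 ηinv (qp F0 ηinv (v (g 0)) (v (g 1))) (v (g 2)), v (g 3)] t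
    - ∑ α, corr F0 [qp F0 ηinv (v (g 0)) (v (g 1)), v (g 2), v (g 3), dua ηinv α] t *
        corr F1 [bas α] t
    + 2 * ∑ α, corr F0 [v (g 0), v (g 1), v (g 2), dua ηinv α] t *
        corr F1 [qp F0 ηinv (bas α) (v (g 3))] t)

section PartialDerivatives

variable {N : ℕ} {F H : Pt N → ℂ}

theorem fderiv_eq_sum_pd (F : Pt N → ℂ) (t v : Pt N) :
    fderiv ℂ F t v = ∑ α, v α * pd α F t := by
  conv_lhs => rw [pi_eq_sum_univ' v]
  simp only [map_sum, map_smul, smul_eq_mul, pd]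

theorem analyticAt_pd (hF : ∀ t, AnalyticAt ℂ F t) (α : Fin N) (t : Pt N) :
    AnalyticAt ℂ (pd α F) t :=
  ((ContinuousLinearMap.apply ℂ ℂ (Pi.single α 1 : Pt N)).analyticAt _).comp (hF t).fderiv

theorem pd_comm (hF : ∀ t, AnalyticAt ℂ F t) (α β : Fin N) :
    pd α (pd β F) = pd β (pd α F) := by
  funext t
  have hd : DifferentiableAt ℂ (fderiv ℂ F) t := (hF t).fderiv.differentiableAt
  have key : ∀ μ ν : Fin N, pd μ (pd ν F) t
      = fderiv ℂ (fderiv ℂ F) t (Pi.single μ 1) (Pi.single ν 1) := by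
    intro μ ν
    change fderiv ℂ (fun s => fderiv ℂ F s (Pi.single ν 1)) t (Pi.single μ 1) = _
    rw [fderiv_clm_apply hd (differentiableAt_const _)]
    simp
  rw [key, key]
  exact ((hF t).contDiffAt (n := ⊤)).isSymmSndFDerivAt (by simp) _ _

theorem pd_add {t : Pt N} (hF : DifferentiableAt ℂ F t) (hH : DifferentiableAt ℂ H t)
    (μ : Fin N) : pd μ (fun s => F s + H s) t = pd μ F t + pd μ H t := by
  simp [pd, fderiv_fun_add hF hH]

theorem pd_const_mul {t : Pt N} (hF : DifferentiableAt ℂ F t) (k : ℂ) (μ : Fin N) :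
    pd μ (fun s => k * F s) t = k * pd μ F t := by
  simp [pd, fderiv_const_mul hF k]

theorem pd_mul {t : Pt N} (hF : DifferentiableAt ℂ F t) (hH : DifferentiableAt ℂ H t)
    (μ : Fin N) : pd μ (fun s => F s * H s) t = F t * pd μ H t + H t * pd μ F t := by
  simp [pd, fderiv_fun_mul hF hH]

theorem pd_sum {ι : Type*} (u : Finset ι) {A : ι → Pt N → ℂ} {t : Pt N}
    (hA : ∀ i ∈ u, DifferentiableAt ℂ (A i) t) (μ : Fin N) :
    pd μ (fun s => ∑ i ∈ u, A i s) t = ∑ i ∈ u, pd μ (A i) t := by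
  simp [pd, fderiv_fun_sum hA]

theorem pd_const (k : ℂ) (μ : Fin N) : pd μ (fun _ => k) = 0 := by
  funext t
  simp [pd]

theorem pd_coord (α μ : Fin N) (t : Pt N) :
    pd μ (fun s => s α) t = (Pi.single μ 1 : Pt N) α := by
  simp [pd, fderiv_apply]

theorem pd_euler (c : Pt N) (b : Fin N → ℂ) (b1 : ℂ) (α μ : Fin N) (t : Pt N) :
    pd μ (fun s => euler c b b1 s α) t = (b1 + 1 - b α) * (Pi.single μ 1 : Pt N) α := by
  unfold euler
  rw [pd_add (by fun_prop) (by fun_prop), pd_const_mul (by fun_prop), pd_coord, pd_const]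
  simp

/-- Differentiating a quasi-homogeneity equation lowers the degree of homogeneity by the
weight of the coordinate. -/
theorem euler_quasiHomogeneous_pd (c : Pt N) (b : Fin N → ℂ) (b1 k : ℂ) {Q : Pt N → ℂ}
    (hF : ∀ t, AnalyticAt ℂ F t) (hQ : Differentiable ℂ Q)
    (h : ∀ t, ∑ α, euler c b b1 t α * pd α F t = k * F t + Q t) (μ : Fin N) (t : Pt N) :
    ∑ α, euler c b b1 t α * pd α (pd μ F) t
      = (k - (b1 + 1 - b μ)) * pd μ F t + pd μ Q t := by
  have hE : ∀ α, DifferentiableAt ℂ (fun s => euler c b b1 s α) t := fun α => by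
    unfold euler
    fun_prop
  have hp : ∀ α, DifferentiableAt ℂ (pd α F) t := fun α =>
    (analyticAt_pd hF α t).differentiableAt
  have hd := congrFun (congrArg (pd μ) (funext h)) t
  rw [pd_sum _ (fun α _ => (hE α).fun_mul (hp α)),
    pd_add ((hF t).differentiableAt.const_mul k) (hQ t),
    pd_const_mul (hF t).differentiableAt] at hd
  simp only [pd_mul (hE _) (hp _), pd_euler, Finset.sum_add_distrib, pd_comm hF μ] at hd
  have hs : ∑ α, pd α F t * ((b1 + 1 - b α) * (Pi.single μ 1 : Pt N) α)
      = (b1 + 1 - b μ) * pd μ F t := by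
    simp [Pi.single_apply, mul_comm]
  rw [hs] at hd
  linear_combination hd

theorem pd_quadratic (C : Matrix (Fin N) (Fin N) ℂ) (μ : Fin N) :
    pd μ (fun t => (1/2) * ∑ α, ∑ β, C α β * t α * t β)
      = fun t => ∑ α, (1/2) * (C μ α + C α μ) * t α := by
  funext t
  rw [pd_const_mul (by fun_prop), pd_sum _ (fun _ _ => by fun_prop)]
  have hin : ∀ α, pd μ (fun s => ∑ β, C α β * s α * s β) t
      = C α μ * t α + ∑ β, t β * (C α β * (Pi.single μ 1 : Pt N) α) := by
    intro α
    rw [pd_sum _ (fun _ _ => by fun_prop)]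
    have hterm : ∀ β, pd μ (fun s => C α β * s α * s β) t
        = C α β * t α * (Pi.single μ 1 : Pt N) β
          + t β * (C α β * (Pi.single μ 1 : Pt N) α) := by
      intro β
      rw [pd_mul (by fun_prop) (by fun_prop), pd_const_mul (by fun_prop), pd_coord, pd_coord]
    simp only [hterm, Finset.sum_add_distrib]
    simp [Pi.single_apply]
  simp only [hin, Finset.sum_add_distrib]
  rw [Finset.sum_comm]
  simp only [Pi.single_apply, mul_ite, mul_one, mul_zero, Finset.sum_ite_eq', Finset.mem_univ,
    if_true, ← Finset.sum_add_distrib, Finset.mul_sum]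
  refine Finset.sum_congr rfl fun α _ => ?_
  ring

theorem pd_linear (a : Fin N → ℂ) (μ : Fin N) :
    pd μ (fun t => ∑ α, a α * t α) = fun _ => a μ := by
  funext t
  rw [pd_sum _ (fun _ _ => by fun_prop)]
  simp [pd_const_mul, pd_coord, differentiableAt_apply, Pi.single_apply]

/-- The third partial derivatives of a quasi-homogeneous potential are quasi-homogeneous; the
quadratic anomaly no longer contributes. -/
theorem euler_quasiHomogeneous_third_pd (c : Pt N) (b : Fin N → ℂ) (b1 : ℂ)
    (C : Matrix (Fin N) (Fin N) ℂ) (hF : ∀ t, AnalyticAt ℂ F t)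
    (hqh : ∀ t, fderiv ℂ F t (euler c b b1 t)
      = 2 * (b1 + 1) * F t + (1/2) * ∑ α, ∑ β, C α β * t α * t β)
    (μ ν β : Fin N) (t : Pt N) :
    ∑ α, euler c b b1 t α * pd β (pd ν (pd μ (pd α F))) t
      = (b μ + b ν + b β - b1 - 1) * pd β (pd ν (pd μ F)) t := by
  have hμ := analyticAt_pd hF μ
  have h0 := fun t => (fderiv_eq_sum_pd F t _).symm.trans (hqh t)
  have h1 := euler_quasiHomogeneous_pd c b b1 _ hF (by fun_prop) h0 μ
  simp only [pd_quadratic] at h1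
  have h2 := euler_quasiHomogeneous_pd c b b1 _ hμ (by fun_prop) h1 ν
  simp only [pd_linear] at h2
  have h3 := euler_quasiHomogeneous_pd c b b1 _ (analyticAt_pd hμ ν) (by fun_prop) h2 β t
  simp only [pd_const] at h3
  have hc : ∀ α, pd β (pd ν (pd μ (pd α F))) = pd α (pd β (pd ν (pd μ F))) := fun α => by
    rw [pd_comm hF μ α, pd_comm hμ ν α, pd_comm (analyticAt_pd hμ ν) β α]
  simp only [hc, h3, Pi.zero_apply]
  ring

end PartialDerivatives

/-- Euler insertion in the genus-0 four-point function:
`Σ_α ⟨⟨E v₁ v₂ γ^α⟩⟩₀ γ_α = G(v₁)∘v₂ + v₁∘G(v₂) − G(v₁∘v₂) − b₁ v₁∘v₂`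
for all constant vector fields `v₁, v₂`. -/
theorem euler_insertion_four_point
    {N : ℕ} [NeZero N]
    (ηm ηinv : Matrix (Fin N) (Fin N) ℂ)
    (hηsym : ηm.IsSymm)
    (hη1 : ηm * ηinv = 1) (hη2 : ηinv * ηm = 1)
    (b : Fin N → ℂ)
    (hb : ∀ α β, ηinv α β ≠ 0 → b α + b β = 1)
    (c : Pt N) (C : Matrix (Fin N) (Fin N) ℂ) (hC : C.IsSymm)
    (F0 : Pt N → ℂ)
    (hF0 : ∀ t, AnalyticAt ℂ F0 t)
    (hqh0 : ∀ t, fderiv ℂ F0 t (euler c b (b 0) t)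
      = 2 * (b 0 + 1) * F0 t + (1/2) * ∑ α, ∑ β, C α β * t α * t β) :
    ∀ (x y : Pt N) (t : Pt N),
      ∑ α, corr F0 [euler c b (b 0), cvf x, cvf y, dua ηinv α] t • (Pi.single α 1 : Pt N)
        = qp F0 ηinv (Gop b (cvf x)) (cvf y) t
          + qp F0 ηinv (cvf x) (Gop b (cvf y)) t
          - Gop b (qp F0 ηinv (cvf x) (cvf y)) t
          - b 0 • qp F0 ηinv (cvf x) (cvf y) t := by
  intro x y t
  funext σ
  have hl : (∑ α, corr F0 [euler c b (b 0), cvf x, cvf y, dua ηinv α] t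
      • (Pi.single α 1 : Pt N)) σ = corr F0 [euler c b (b 0), cvf x, cvf y, dua ηinv σ] t := by
    simp [Finset.sum_apply, Pi.single_apply]
  rw [hl]
  simp only [Pi.sub_apply, Pi.add_apply, Pi.smul_apply, smul_eq_mul, Gop, qp, corr, cvf, dua,
    Finset.mul_sum]
  rw [Finset.sum_comm]
  simp only [← Finset.sum_add_distrib, ← Finset.sum_sub_distrib]
  refine Finset.sum_congr rfl fun μ _ => ?_
  rw [Finset.sum_comm]
  refine Finset.sum_congr rfl fun ν _ => ?_
  rw [Finset.sum_comm]
  refine Finset.sum_congr rfl fun β _ => ?_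
  have h := euler_quasiHomogeneous_third_pd c b (b 0) C hF0 hqh0 μ ν β t
  have hs : ∑ α, euler c b (b 0) t α
        * (x μ * (y ν * (ηinv σ β * pd β (pd ν (pd μ (pd α F0))) t)))
      = x μ * y ν * ηinv σ β * ∑ α, euler c b (b 0) t α * pd β (pd ν (pd μ (pd α F0))) t := by
    rw [Finset.mul_sum]
    exact Finset.sum_congr rfl fun α _ => by ring
  rw [hs, h]
  by_cases hz : ηinv σ β = 0
  · simp [hz]
  · linear_combination x μ * y ν * ηinv σ β * pd β (pd ν (pd μ F0)) t * hb σ β hz
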